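/- arXiv:1305.5121 — 2 statements merged into one kernel-verified Lean document; each statement's English description precedes it below -/
import Mathlib

section
/- Let A = (L/F, σ, a) be a nonassociative cyclic algebra of degree n, and suppose that the stabiliser of a in Gal(L/F) = ⟨σ⟩ is the nontrivial proper subgroup generated by σ^s (where s is a divisor of n with 2 ≤ s ≤ n−1, so that σ^k(a) = a if and only if s divides k). Then the left nucleus of A is Nuc_l(A) = L ⊕ L z^s ⊕ L z^{2s} ⊕ ⋯ ⊕ L z^{n−s}, i.e. the L-span of the basis elements z^m with s dividing m. -/
noncomputable section

/-- Multiplication of the nonassociative cyclic algebra `(L/F, σ, a)` of degree `n`. -/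
def cycMul {F L : Type*} [Field F] [Field L] [Algebra F L] (n : ℕ)
    (σ : L ≃ₐ[F] L) (a : L) (x y : Fin n → L) : Fin n → L :=
  fun k => ∑ i : Fin n, ∑ j : Fin n,
    if (i : ℕ) + (j : ℕ) = (k : ℕ) then x i * (σ ^ (i : ℕ)) (y j)
    else if (i : ℕ) + (j : ℕ) = (k : ℕ) + n then x i * (σ ^ (i : ℕ)) (y j) * a
    else 0

/-- The associator `[x,y,z] = (xy)z - x(yz)` in `(L/F, σ, a)`. -/
def cycAssoc {F L : Type*} [Field F] [Field L] [Algebra F L] (n : ℕ)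
    (σ : L ≃ₐ[F] L) (a : L) (x y z : Fin n → L) : Fin n → L :=
  cycMul n σ a (cycMul n σ a x y) z - cycMul n σ a x (cycMul n σ a y z)

section

variable {F L : Type*} [Field F] [Field L] [Algebra F L]

/-- The factor `1` or `a` picked up by `z ^ i * z ^ (k - i)`, exponents being read modulo `n`. -/
def wrap {n : ℕ} (a : L) (i k : Fin n) : L := if i ≤ k then 1 else a

lemma wrap_mul_wrap {n : ℕ} (a : L) (i m k : Fin n) :
    wrap a i m * wrap a m k = wrap a (m - i) (k - i) * wrap a i k := by
  have hm := Fin.val_sub m i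
  have hk := Fin.val_sub k i
  have hsub (u v : ℕ) (hu : u < n) (hv : v < n) :
      (n - u + v) % n = if u ≤ v then v - u else n - u + v := by
    split_ifs with h
    · rw [show n - u + v = v - u + n by omega, Nat.add_mod_right, Nat.mod_eq_of_lt (by omega)]
    · exact Nat.mod_eq_of_lt (by omega)
  rw [hsub _ _ i.2 m.2] at hm
  rw [hsub _ _ i.2 k.2] at hk
  have := i.2
  have := m.2
  have := k.2
  simp only [wrap, Fin.le_def, hm, hk]
  split_ifs <;> first | omega | simp

lemma cycMul_apply (n : ℕ) [NeZero n] (σ : L ≃ₐ[F] L) (a : L) (x y : Fin n → L) (k : Fin n) :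
    cycMul n σ a x y k = ∑ i : Fin n, x i * (σ ^ (i : ℕ)) (y (k - i)) * wrap a i k := by
  unfold cycMul
  refine Finset.sum_congr rfl fun i _ => ?_
  have hki : ((k - i : Fin n) : ℕ) = if (i : ℕ) ≤ k then (k : ℕ) - i else n - i + k := by
    rw [Fin.val_sub]
    split_ifs with h
    · rw [show n - (i : ℕ) + k = k - i + n by omega, Nat.add_mod_right,
        Nat.mod_eq_of_lt (by omega)]
    · exact Nat.mod_eq_of_lt (by omega)
  rw [Finset.sum_eq_single (k - i)]
  · simp only [wrap, Fin.le_def, hki]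
    have := i.2
    split_ifs <;> first | omega | simp
  · intro j _ hj
    have hj' : (j : ℕ) ≠ (k - i : Fin n) := fun h => hj (Fin.ext h)
    rw [hki] at hj'
    have := i.2
    have := j.2
    split_ifs at hj' ⊢ <;> first | omega | rfl
  · simp

lemma pow_val_add {G : Type*} [Monoid G] {n : ℕ} {g : G} (hg : g ^ n = 1) (i j : Fin n) :
    g ^ ((i + j : Fin n) : ℕ) = g ^ (i : ℕ) * g ^ (j : ℕ) := by
  rw [Fin.val_add, ← pow_add, ← pow_eq_pow_mod _ hg]

lemma cycAssoc_eq_zero {n : ℕ} [NeZero n] {σ : L ≃ₐ[F] L} (hσ : σ ^ n = 1) {a : L}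
    {x : Fin n → L} (hx : ∀ i, x i ≠ 0 → (σ ^ (i : ℕ)) a = a) (y z : Fin n → L) :
    cycAssoc n σ a x y z = 0 := by
  refine sub_eq_zero.2 (funext fun k => ?_)
  simp only [cycMul_apply, Finset.sum_mul, map_sum, Finset.mul_sum]
  rw [Finset.sum_comm]
  refine Finset.sum_congr rfl fun i _ => ?_
  rw [← Equiv.sum_comp (Equiv.addLeft i)]
  refine Finset.sum_congr rfl fun j _ => ?_
  by_cases hi : x i = 0
  · simp [hi]
  have hw : (σ ^ (i : ℕ)) (wrap a j (k - i)) = wrap a j (k - i) := by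
    unfold wrap
    split_ifs
    · simp
    · exact hx i hi
  have hc := wrap_mul_wrap a i (i + j) k
  rw [add_sub_cancel_left] at hc
  simp only [Equiv.coe_addLeft, add_sub_cancel_left, map_mul, hw, pow_val_add hσ,
    AlgEquiv.mul_apply, sub_add_eq_sub_sub]
  linear_combination
    x i * (σ ^ (i : ℕ)) (y j) * (σ ^ (i : ℕ)) ((σ ^ (j : ℕ)) (z (k - i - j))) * hc

lemma cycMul_single (n : ℕ) [NeZero n] (σ : L ≃ₐ[F] L) (a b : L) (x : Fin n → L)
    (j k : Fin n) :
    cycMul n σ a x (Pi.single j b) k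
      = x (k - j) * (σ ^ ((k - j : Fin n) : ℕ)) b * wrap a (k - j) k := by
  rw [cycMul_apply, Finset.sum_eq_single (k - j)]
  · simp
  · intro i _ hi
    have : k - i ≠ j := fun h => hi (by rw [← h, sub_sub_cancel])
    simp [this]
  · simp

lemma wrap_succ_mul_wrap {n : ℕ} [NeZero n] (hn : 2 ≤ n) (a : L) (k : Fin n) :
    wrap a k (k + 1) * wrap a (k + 1) k = a := by
  have h1 : (1 : Fin n) ≠ 0 := by
    rw [Ne, Fin.ext_iff, Fin.val_zero, Fin.val_one']
    rw [Nat.mod_eq_of_lt (by omega)]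
    exact one_ne_zero
  have hne : k ≠ k + 1 := by simpa using h1
  unfold wrap
  rcases lt_or_gt_of_ne hne with h | h
  · simp [h.le, h.not_ge]
  · simp [h.le, h.not_ge]

lemma fixes_of_cycAssoc_eq_zero {n : ℕ} [NeZero n] (hn : 2 ≤ n) {σ : L ≃ₐ[F] L} {a : L}
    {x : Fin n → L} (hx : ∀ y z, cycAssoc n σ a x y z = 0) {k : Fin n} (hk : x k ≠ 0) :
    (σ ^ (k : ℕ)) a = a := by
  have hyz : cycMul n σ a (Pi.single 1 1) (Pi.single (-1) 1) = Pi.single 0 a := by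
    funext m
    rw [cycMul_single, sub_neg_eq_add]
    by_cases hm : m = 0
    · subst hm
      simpa [wrap] using wrap_succ_mul_wrap hn a 0
    · simp [hm]
  have h := congrFun (sub_eq_zero.1 (hx (Pi.single 1 1) (Pi.single (-1) 1))) k
  rw [hyz, cycMul_single, cycMul_single, cycMul_single] at h
  have hc := wrap_succ_mul_wrap hn a k
  simp only [sub_neg_eq_add, add_sub_cancel_right, map_one, mul_one, sub_zero, mul_assoc, hc] at h
  simpa [wrap, hk, eq_comm] using h

end

/-- if the stabiliser of `a` in `Gal(L/F) = ⟨σ⟩` is the nontrivial proper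
subgroup generated by `σ^s` (so `σ^k(a) = a` iff `s ∣ k`, where `s ∣ n` and `2 ≤ s ≤ n-1`),
then the left nucleus of `A = (L/F, σ, a)` is `L ⊕ L z^s ⊕ L z^{2s} ⊕ ⋯ ⊕ L z^{n-s}`,
i.e. the `L`-span of the basis elements `z^m` with `s ∣ m`. -/
theorem sandler_left_nucleus
    {F L : Type*} [Field F] [Field L] [Algebra F L] [IsGalois F L]
    (n : ℕ) (hn : 2 ≤ n) (hrank : Module.finrank F L = n)
    (σ : L ≃ₐ[F] L) (hσ : ∀ τ : L ≃ₐ[F] L, τ ∈ Subgroup.zpowers σ)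
    (a : L) (ha : a ∉ Set.range (algebraMap F L))
    (s : ℕ) (hs2 : 2 ≤ s) (hs1 : s ≤ n - 1) (hsn : s ∣ n)
    (hstab : ∀ k : ℕ, (σ ^ k) a = a ↔ s ∣ k) :
    {x : Fin n → L | ∀ y z : Fin n → L, cycAssoc n σ a x y z = 0}
      = {x : Fin n → L | ∀ i : Fin n, ¬ s ∣ (i : ℕ) → x i = 0} := by
  have : NeZero n := ⟨by omega⟩
  have : FiniteDimensional F L := Module.finite_of_finrank_pos (by omega)
  have hσn : σ ^ n = 1 := by
    rw [← hrank, ← IsGalois.card_aut_eq_finrank]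
    exact pow_card_eq_one'
  ext x
  constructor
  · intro hx i hi
    by_contra h
    exact hi ((hstab i).1 (fixes_of_cycAssoc_eq_zero hn hx h))
  · intro hx
    exact cycAssoc_eq_zero hσn fun i hi => (hstab i).2 (by_contra fun h => hi (hx i h))
end
end

section
/- Let F = 𝔽_q with q a prime power and let L be the field extension of F of prime degree r, with Gal(L/F) generated by σ. If r does not divide q−1, then for every a ∈ L \ F the group of F-algebra automorphisms of the nonassociative cyclic algebra (L/F, σ, a) is isomorphic to the cyclic group ℤ/sℤ, where s = (q^r − 1)/(q − 1). -/
noncomputable section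

/-- The unit element `1 = z^0` of `(L/F, σ, a)`. -/
def cycOne (L : Type*) [Field L] (n : ℕ) : Fin n → L :=
  fun k => if (k : ℕ) = 0 then 1 else 0


/-- The automorphism group (as a subgroup of the group of `F`-linear self-equivalences)
of a not-necessarily-associative algebra given by a multiplication `mul` and unit `one`
on an `F`-vector space `M`. -/
def ntAut (F M : Type*) [Field F] [AddCommGroup M] [Module F M]
    (mul : M → M → M) (one : M) : Subgroup (M ≃ₗ[F] M) where
  carrier := {e | (∀ x y : M, e (mul x y) = mul (e x) (e y)) ∧ e one = one}
  one_mem' := ⟨fun _ _ => rfl, rfl⟩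
  mul_mem' := by
    rintro e f ⟨he, he1⟩ ⟨hf, hf1⟩
    refine ⟨fun x y => ?_, ?_⟩
    · show e (f (mul x y)) = mul (e (f x)) (e (f y))
      rw [hf, he]
    · show e (f one) = one
      rw [hf1, he1]
  inv_mem' := by
    rintro e ⟨he, he1⟩
    refine ⟨fun x y => ?_, ?_⟩
    · apply e.injective
      show e (e.symm (mul x y)) = e (mul (e.symm x) (e.symm y))
      rw [e.apply_symm_apply, he, e.apply_symm_apply, e.apply_symm_apply]
    · apply e.injective
      show e (e.symm one) = e one
      rw [e.apply_symm_apply, he1]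

section CyclicAlgebra

variable {F L : Type*} [Field F] [Field L] [Algebra F L] {n : ℕ} {σ : L ≃ₐ[F] L} {a : L}

/-- The partial norm `k * σ k * ⋯ * σ ^ (i - 1) k`. -/
def partialNorm (σ : L ≃ₐ[F] L) (i : ℕ) (k : L) : L :=
  ∏ t ∈ Finset.range i, (σ ^ t) k

@[simp]
lemma partialNorm_zero (σ : L ≃ₐ[F] L) (k : L) : partialNorm σ 0 k = 1 := by
  simp [partialNorm]

@[simp]
lemma partialNorm_one (σ : L ≃ₐ[F] L) (k : L) : partialNorm σ 1 k = k := by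
  simp [partialNorm]

@[simp]
lemma partialNorm_apply_one (σ : L ≃ₐ[F] L) (i : ℕ) : partialNorm σ i 1 = 1 := by
  simp [partialNorm]

lemma partialNorm_mul (σ : L ≃ₐ[F] L) (i : ℕ) (k l : L) :
    partialNorm σ i (k * l) = partialNorm σ i k * partialNorm σ i l := by
  simp [partialNorm, Finset.prod_mul_distrib]

lemma partialNorm_add (σ : L ≃ₐ[F] L) (i j : ℕ) (k : L) :
    partialNorm σ (i + j) k = partialNorm σ i k * (σ ^ i) (partialNorm σ j k) := by
  simp only [partialNorm, Finset.prod_range_add, map_prod, pow_add, AlgEquiv.mul_apply]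

lemma partialNorm_orderOf [FiniteDimensional F L] [IsGalois F L]
    (hσ : ∀ τ : L ≃ₐ[F] L, τ ∈ Subgroup.zpowers σ) (k : L) :
    partialNorm σ (orderOf σ) k = algebraMap F L (Algebra.norm F k) := by
  classical
  rw [Algebra.norm_eq_prod_automorphisms, partialNorm]
  refine Finset.prod_bij (fun t _ => σ ^ t) (fun _ _ => Finset.mem_univ _) ?_ ?_ (fun _ _ => rfl)
  · intro s hs t ht h
    exact pow_injOn_Iio_orderOf (by simpa using hs) (by simpa using ht) h
  · intro τ _
    obtain ⟨t, ht, h⟩ := Finset.mem_image.1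
      (((isOfFinOrder_of_finite σ).mem_zpowers_iff_mem_range_orderOf).1 (hσ τ))
    exact ⟨t, ht, h⟩

section Multiplication

lemma cycMul_single_left_of_add_eq (i j k : Fin n) (h : (i : ℕ) + j = k) (m : L)
    (y : Fin n → L) : cycMul n σ a (Pi.single i m) y k = m * (σ ^ (i : ℕ)) (y j) := by
  rw [cycMul, Finset.sum_eq_single i, Finset.sum_eq_single j]
  · simp [h]
  · intro b _ hb
    have hb' : (b : ℕ) ≠ j := fun h => hb (Fin.ext h)
    rw [if_neg (by omega), if_neg (by omega)]
  · simp
  · intro b _ hb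
    simp [Pi.single_eq_of_ne hb]
  · simp

lemma cycMul_single_left_of_add_eq_add (i j k : Fin n) (h : (i : ℕ) + j = k + n) (m : L)
    (y : Fin n → L) : cycMul n σ a (Pi.single i m) y k = m * (σ ^ (i : ℕ)) (y j) * a := by
  have hn : n ≠ 0 := by have := k.2; omega
  rw [cycMul, Finset.sum_eq_single i, Finset.sum_eq_single j]
  · simp [h, hn]
  · intro b _ hb
    have hb' : (b : ℕ) ≠ j := fun h => hb (Fin.ext h)
    rw [if_neg (by omega), if_neg (by omega)]
  · simp
  · intro b _ hb
    simp [Pi.single_eq_of_ne hb]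
  · simp

variable [NeZero n]

lemma cycMul_single_zero_left (l : L) (y : Fin n → L) :
    cycMul n σ a (Pi.single 0 l) y = fun k => l * y k := by
  funext k
  rw [cycMul_single_left_of_add_eq 0 k k (by simp)]
  simp

lemma cycMul_single_zero_right (l : L) (x : Fin n → L) :
    cycMul n σ a x (Pi.single 0 l) = fun k => x k * (σ ^ (k : ℕ)) l := by
  funext k
  rw [cycMul, Finset.sum_eq_single k, Finset.sum_eq_single 0]
  · simp
  · intro b _ hb
    simp [Pi.single_eq_of_ne hb]
  · simp
  · intro b _ hb
    have hb' : (b : ℕ) ≠ k := fun h => hb (Fin.ext h)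
    refine Finset.sum_eq_zero fun j _ => ?_
    rcases eq_or_ne j 0 with rfl | hj
    · have := b.2
      rw [Fin.val_zero, if_neg (by omega), if_neg (by omega)]
    · simp [Pi.single_eq_of_ne hj]
  · simp

lemma cycOne_eq_single : cycOne L n = Pi.single 0 1 := by
  funext k
  simp only [cycOne, Pi.single_apply, Fin.ext_iff, Fin.val_zero]

lemma cycMul_single_zero_assoc (hn : σ ^ n = 1) (x y : Fin n → L) (l : L) :
    cycMul n σ a (cycMul n σ a x y) (Pi.single 0 l) =
      cycMul n σ a x (cycMul n σ a y (Pi.single 0 l)) := by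
  simp only [cycMul_single_zero_right]
  funext k
  simp only [cycMul, Finset.sum_mul]
  refine Finset.sum_congr rfl fun i _ => Finset.sum_congr rfl fun j _ => ?_
  have key : (σ ^ (i : ℕ)) (y j * (σ ^ (j : ℕ)) l) =
      (σ ^ (i : ℕ)) (y j) * (σ ^ ((i : ℕ) + j)) l := by
    rw [map_mul, pow_add, AlgEquiv.mul_apply]
  rw [key]
  split_ifs with h1 h2
  · rw [h1]; ring
  · rw [h2, pow_add, hn, mul_one]; ring
  · simp

/-- An element that right-associates with `z` and `z ^ (n - 1)` lies in `L`. -/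
lemma eq_single_zero_of_assoc (hn : σ ^ n = 1) (ha : σ a ≠ a) (h2 : 2 ≤ n) (x : Fin n → L)
    (hx : ∀ y w : Fin n → L,
      cycMul n σ a (cycMul n σ a y w) x = cycMul n σ a y (cycMul n σ a w x)) :
    x = Pi.single 0 (x 0) := by
  funext k
  rcases eq_or_ne k 0 with rfl | hk
  · simp
  rw [Pi.single_eq_of_ne hk]
  have hk0 : (k : ℕ) ≠ 0 := fun h => hk (Fin.ext (by simpa using h))
  have hkn := k.2
  let z : Fin n → L := Pi.single ⟨1, by omega⟩ 1
  let w : Fin n → L := Pi.single ⟨n - 1, by omega⟩ 1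
  have hzw : cycMul n σ a z w = Pi.single 0 a := by
    funext i
    rcases eq_or_ne i 0 with rfl | hi
    · rw [cycMul_single_left_of_add_eq_add _ ⟨n - 1, by omega⟩ _ (by simp; omega)]
      simp [w]
    · have hi0 : (i : ℕ) ≠ 0 := fun h => hi (Fin.ext (by simpa using h))
      have := i.2
      rw [cycMul_single_left_of_add_eq _ ⟨i - 1, by omega⟩ _ (by simp; omega),
        Pi.single_eq_of_ne hi]
      simp only [w]
      rw [Pi.single_eq_of_ne (by simp [Fin.ext_iff]; omega)]
      simp
  have h := congrFun (hx z w) k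
  rw [hzw, cycMul_single_zero_left,
    cycMul_single_left_of_add_eq _ ⟨k - 1, by omega⟩ _ (by simp; omega),
    cycMul_single_left_of_add_eq_add _ k _ (by simp; omega)] at h
  have hs : σ ((σ ^ (n - 1)) (x k)) = x k := by
    rw [← AlgEquiv.mul_apply, ← pow_succ', Nat.sub_add_cancel (by omega), hn,
      AlgEquiv.one_apply]
  simp only [one_mul, pow_one, map_mul, hs] at h
  by_contra hne
  exact ha (mul_left_cancel₀ hne (by rw [← h, mul_comm]))

end Multiplication

/-- Every automorphism of `(L/F, σ, a)` has the form `∑ xᵢ zⁱ ↦ ∑ τ(xᵢ) (k z)ⁱ`. -/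
theorem exists_of_mem_ntAut [FiniteDimensional F L]
    (hσ : ∀ τ : L ≃ₐ[F] L, τ ∈ Subgroup.zpowers σ) (hn : orderOf σ = n) (h2 : 2 ≤ n)
    (ha : σ a ≠ a) (e : (Fin n → L) ≃ₗ[F] (Fin n → L))
    (he : e ∈ ntAut F (Fin n → L) (cycMul n σ a) (cycOne L n)) :
    ∃ (τ : L ≃ₐ[F] L) (k : L), τ a = partialNorm σ n k * a ∧
      ∀ x i, e x i = τ (x i) * partialNorm σ i k := by
  have : NeZero n := ⟨by omega⟩
  obtain ⟨hmul, hone⟩ := he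
  rw [cycOne_eq_single] at hone
  have hσn : σ ^ n = 1 := hn ▸ pow_orderOf_eq_one σ
  have hL (l : L) : e (Pi.single 0 l) = Pi.single 0 (e (Pi.single 0 l) 0) := by
    refine eq_single_zero_of_assoc hσn ha h2 _ fun y w => ?_
    obtain ⟨y, rfl⟩ := e.surjective y
    obtain ⟨w, rfl⟩ := e.surjective w
    simp only [← hmul, cycMul_single_zero_assoc hσn]
  let f : L →ₐ[F] L := AlgHom.ofLinearMap
    ((LinearMap.proj (0 : Fin n)) ∘ₗ e.toLinearMap ∘ₗ
      (LinearMap.single F (fun _ : Fin n => L) 0))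
    (by simp [hone])
    (by
      intro l m
      have h := hmul (Pi.single 0 l) (Pi.single 0 m)
      rw [cycMul_single_zero_left, hL l, cycMul_single_zero_left] at h
      have h' : (fun k => l * (Pi.single 0 m : Fin n → L) k) = Pi.single 0 (l * m) := by
        funext k
        simp [Pi.single_apply]
      rw [h'] at h
      exact congrFun h 0)
  let τ : L ≃ₐ[F] L := AlgEquiv.ofBijective f (Algebra.IsAlgebraic.algHom_bijective f)
  have hτ (l : L) : e (Pi.single 0 l) = Pi.single 0 (τ l) := hL l
  have hcomm (l : L) : σ (τ l) = τ (σ l) := by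
    obtain ⟨t, ht⟩ := hσ τ
    have : σ * τ = τ * σ := by
      rw [← ht]
      exact ((Commute.refl σ).zpow_right t).eq
    exact congrArg (· l) this
  let u : Fin n := ⟨1, by omega⟩
  let k : L := e (Pi.single u 1) u
  have hleft (l : L) (i : Fin n) :
      cycMul n σ a (Pi.single 0 l) (Pi.single i 1) = Pi.single i l := by
    rw [cycMul_single_zero_left]
    funext k
    simp [Pi.single_apply]
  have hz : e (Pi.single u 1) = Pi.single u k := by
    funext j
    rcases eq_or_ne j u with rfl | hj
    · simp [k]
    rw [Pi.single_eq_of_ne hj]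
    by_contra hne
    apply hj
    have hpow : σ ^ (j : ℕ) = σ := by
      ext m
      obtain ⟨l, rfl⟩ := τ.surjective m
      have h1 : cycMul n σ a (Pi.single u 1) (Pi.single 0 l) =
          cycMul n σ a (Pi.single 0 (σ l)) (Pi.single u 1) := by
        rw [hleft, cycMul_single_zero_right]
        funext i
        rcases eq_or_ne i u with rfl | hi
        · simp [u]
        · simp [Pi.single_eq_of_ne hi]
      have h := congrArg e h1
      rw [hmul, hmul, hτ, hτ, cycMul_single_zero_left, cycMul_single_zero_right] at h
      have h' := congrFun h j
      rw [hcomm]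
      exact mul_left_cancel₀ hne (h'.trans (mul_comm _ _))
    refine Fin.ext (pow_injOn_Iio_orderOf (x := σ) ?_ ?_ ?_)
    · simp [hn]
    · simp [hn]
    · simpa [u] using hpow
  have hzpow (i : ℕ) (hi : i < n) :
      e (Pi.single ⟨i, hi⟩ 1) = Pi.single ⟨i, hi⟩ (partialNorm σ i k) := by
    induction i with
    | zero => simpa using hone
    | succ i ih =>
      have hstep (m l : L) : cycMul n σ a (Pi.single u m) (Pi.single ⟨i, by omega⟩ l) =
          Pi.single ⟨i + 1, hi⟩ (m * σ l) := by
        funext j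
        have := j.2
        rcases Nat.eq_zero_or_pos (j : ℕ) with h0 | h0
        · rw [cycMul_single_left_of_add_eq_add _ ⟨n - 1, by omega⟩ _ (by simp [u]; omega),
            Pi.single_eq_of_ne (by simp [Fin.ext_iff]; omega),
            Pi.single_eq_of_ne (by simp [Fin.ext_iff]; omega)]
          simp
        · rw [cycMul_single_left_of_add_eq _ ⟨j - 1, by omega⟩ _ (by simp [u]; omega)]
          rcases eq_or_ne (j : ℕ) (i + 1) with h | h
          · obtain rfl : j = ⟨i + 1, hi⟩ := Fin.ext h
            simp [u]
          · rw [Pi.single_eq_of_ne (by simp [Fin.ext_iff]; omega),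
              Pi.single_eq_of_ne (by simp [Fin.ext_iff]; omega)]
            simp
      have h := congrArg e (hstep 1 1)
      rw [hmul, hz, ih, hstep] at h
      have hN : partialNorm σ (i + 1) k = k * σ (partialNorm σ i k) := by
        rw [add_comm, partialNorm_add, partialNorm_one, pow_one]
      rw [hN]
      simpa using h.symm
  have hform (x : Fin n → L) (i : Fin n) : e x i = τ (x i) * partialNorm σ i k := by
    have hsingle (j : Fin n) (l : L) :
        e (Pi.single j l) = Pi.single j (τ l * partialNorm σ j k) := by
      rw [← hleft, hmul, hτ, hzpow j j.2, cycMul_single_zero_left]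
      funext m
      simp [Pi.single_apply]
    conv_lhs => rw [← Finset.univ_sum_single x]
    rw [map_sum, Finset.sum_apply, Finset.sum_eq_single i]
    · simp [hsingle]
    · intro j _ hj
      rw [hsingle, Pi.single_eq_of_ne hj.symm]
    · simp
  refine ⟨τ, k, ?_, hform⟩
  have h := congrFun (hmul (Pi.single u 1) (Pi.single ⟨n - 1, by omega⟩ 1)) 0
  rw [hform, hz, hzpow,
    cycMul_single_left_of_add_eq_add _ ⟨n - 1, by omega⟩ _ (by simp [u]; omega),
    cycMul_single_left_of_add_eq_add _ ⟨n - 1, by omega⟩ _ (by simp [u]; omega)] at h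
  have hN : partialNorm σ n k = k * σ (partialNorm σ (n - 1) k) := by
    conv_lhs => rw [show n = 1 + (n - 1) by omega, partialNorm_add]
    simp
  rw [hN]
  simpa [u] using h

/-- The action of `Lˣ` by the `F`-linear equivalences `∑ xᵢ zⁱ ↦ ∑ xᵢ (k z)ⁱ`. -/
def scaleEquiv (σ : L ≃ₐ[F] L) (n : ℕ) : Lˣ →* ((Fin n → L) ≃ₗ[F] (Fin n → L)) where
  toFun k :=
    { toFun := fun x i => x i * partialNorm σ i k
      map_add' := fun x y => by funext i; simp [add_mul]
      map_smul' := fun c x => by funext i; simp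
      invFun := fun x i => x i * partialNorm σ i ↑k⁻¹
      left_inv := fun x => by
        funext i
        simp [mul_assoc, ← partialNorm_mul]
      right_inv := fun x => by
        funext i
        simp [mul_assoc, ← partialNorm_mul] }
  map_one' := by
    ext x i
    simp
  map_mul' k l := by
    ext x i
    simp [partialNorm_mul, mul_left_comm, mul_comm]

@[simp]
lemma scaleEquiv_apply (k : Lˣ) (x : Fin n → L) (i : Fin n) :
    scaleEquiv σ n k x i = x i * partialNorm σ i k := rfl

lemma scaleEquiv_mem_ntAut (hn : σ ^ n = 1) (k : Lˣ) (hk : partialNorm σ n (k : L) = 1) :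
    scaleEquiv σ n k ∈ ntAut F (Fin n → L) (cycMul n σ a) (cycOne L n) := by
  refine ⟨fun x y => ?_, ?_⟩
  · funext m
    rw [scaleEquiv_apply]
    simp only [cycMul, Finset.sum_mul, scaleEquiv_apply]
    refine Finset.sum_congr rfl fun i _ => Finset.sum_congr rfl fun j _ => ?_
    have key : x i * partialNorm σ i (k : L) * (σ ^ (i : ℕ)) (y j * partialNorm σ j (k : L)) =
        x i * (σ ^ (i : ℕ)) (y j) * partialNorm σ ((i : ℕ) + j) (k : L) := by
      rw [map_mul, partialNorm_add]
      ring
    rw [key]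
    split_ifs with h1 h2
    · rw [h1]
    · rw [h2, add_comm (m : ℕ) n, partialNorm_add, hk, hn, AlgEquiv.one_apply]
      ring
    · simp
  · funext i
    simp only [scaleEquiv_apply, cycOne]
    split_ifs with h <;> simp [h]

lemma scaleEquiv_injective (h2 : 2 ≤ n) : Function.Injective (scaleEquiv (F := F) σ n) := by
  intro k l h
  have h' := congrFun (LinearEquiv.congr_fun h (fun _ => 1)) ⟨1, by omega⟩
  exact Units.ext (by simpa using h')

/-- If `L/F` has prime degree `r` not dividing `|F| - 1`, an automorphism scaling some `a ∉ F` by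
an element of `F` is trivial. -/
lemma eq_one_of_apply_eq_algebraMap_mul [Fintype F] [FiniteDimensional F L] [IsGalois F L]
    {r : ℕ} (hr : r.Prime) (hcard : Nat.card (L ≃ₐ[F] L) = r) (hnd : ¬ r ∣ Fintype.card F - 1)
    (ha : a ∉ Set.range (algebraMap F L)) (τ : L ≃ₐ[F] L) (c : F)
    (hc : τ a = algebraMap F L c * a) : τ = 1 := by
  have ha0 : a ≠ 0 := by
    rintro rfl
    exact ha ⟨0, map_zero _⟩
  have hτr : τ ^ r = 1 := hcard ▸ pow_card_eq_one'
  have hpow (i : ℕ) : (τ ^ i) a = algebraMap F L (c ^ i) * a := by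
    induction i with
    | zero => simp
    | succ i ih =>
      rw [pow_succ, AlgEquiv.mul_apply, hc, map_mul, ih, AlgEquiv.commutes, pow_succ, map_mul]
      ring
  have hcr : c ^ r = 1 := by
    have h := hpow r
    rw [hτr, AlgEquiv.one_apply] at h
    apply (algebraMap F L).injective
    rw [map_one]
    exact mul_right_cancel₀ ha0 (by rw [← h, one_mul])
  have hc0 : c ≠ 0 := by
    rintro rfl
    simp [hr.ne_zero] at hcr
  have hc1 : c = 1 := by
    rw [← orderOf_eq_one_iff]
    exact Nat.eq_one_of_dvd_coprimes ((Nat.Prime.coprime_iff_not_dvd hr).2 hnd)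
      (orderOf_dvd_of_pow_eq_one hcr)
      (orderOf_dvd_of_pow_eq_one (FiniteField.pow_card_sub_one_eq_one c hc0))
  rw [hc1, map_one, one_mul] at hc
  by_contra hτ
  have : Fact r.Prime := ⟨hr⟩
  refine ha ((IsGalois.mem_range_algebraMap_iff_fixed a).2 fun g => ?_)
  obtain ⟨t, rfl⟩ := mem_powers_of_prime_card hcard hτ (g' := g)
  simp [hc1, hpow]

lemma card_ker_unitsMap_norm [Finite F] [FiniteDimensional F L] :
    Nat.card (Units.map (Algebra.norm F (S := L))).ker =
      (Nat.card F ^ Module.finrank F L - 1) / (Nat.card F - 1) := by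
  have : Finite L := Module.finite_of_finite F
  have h := (Units.map (Algebra.norm F (S := L))).ker.card_mul_index
  rw [Subgroup.index_ker,
    MonoidHom.range_eq_top.2 (FiniteField.unitsMap_norm_surjective F L), Subgroup.card_top,
    Nat.card_units, Nat.card_units, Module.natCard_eq_pow_finrank (K := F) (V := L)] at h
  rw [← h, Nat.mul_div_cancel]
  have := Finite.one_lt_card (α := F)
  omega

end CyclicAlgebra

/-- for `F = 𝔽_q` and `L/F` of prime degree `r` with `r ∤ q - 1`, the
automorphism group of `(L/F, σ, a)` is cyclic of order `s = (q^r - 1)/(q - 1)`, i.e.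
isomorphic to `ℤ/sℤ`. -/
theorem sandler_aut_cyclic
    {F L : Type*} [Field F] [Fintype F] [Field L] [Algebra F L] [IsGalois F L]
    (q r : ℕ) (hq : Fintype.card F = q) (hr : r.Prime)
    (hrank : Module.finrank F L = r)
    (σ : L ≃ₐ[F] L) (hσ : ∀ τ : L ≃ₐ[F] L, τ ∈ Subgroup.zpowers σ)
    (hnd : ¬ r ∣ q - 1)
    (a : L) (ha : a ∉ Set.range (algebraMap F L)) :
    Nonempty (↥(ntAut F (Fin r → L) (cycMul r σ a) (cycOne L r)) ≃*
      Multiplicative (ZMod ((q ^ r - 1) / (q - 1)))) := by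
  subst hq
  have : FiniteDimensional F L := FiniteDimensional.of_finrank_pos (hrank ▸ hr.pos)
  have : Finite L := Module.finite_of_finite F
  have hcard : Nat.card (L ≃ₐ[F] L) = r := by rw [IsGalois.card_aut_eq_finrank, hrank]
  have hord : orderOf σ = r := by rw [orderOf_eq_card_of_forall_mem_zpowers hσ, hcard]
  have hσr : σ ^ r = 1 := hord ▸ pow_orderOf_eq_one σ
  have hnorm (k : L) : partialNorm σ r k = algebraMap F L (Algebra.norm F k) :=
    hord ▸ partialNorm_orderOf hσ k
  have hσa : σ a ≠ a := by
    intro h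
    have h1 : σ = 1 := eq_one_of_apply_eq_algebraMap_mul hr hcard hnd ha σ 1 (by simpa using h)
    exact hr.ne_one (hord ▸ orderOf_eq_one_iff.2 h1)
  let G := (Units.map (Algebra.norm F (S := L))).ker
  have hG (k : Lˣ) : k ∈ G ↔ partialNorm σ r (k : L) = 1 := by
    rw [hnorm, MonoidHom.mem_ker, Units.ext_iff, Units.coe_map, Units.val_one,
      ← (algebraMap F L).injective.eq_iff, map_one]
  let Φ : G →* ntAut F (Fin r → L) (cycMul r σ a) (cycOne L r) :=
    ((scaleEquiv σ r).comp G.subtype).codRestrict _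
      fun k => scaleEquiv_mem_ntAut hσr _ ((hG k).1 k.2)
  have hΦ : Function.Bijective Φ := by
    refine ⟨fun k l h => Subtype.ext (scaleEquiv_injective hr.two_le (congrArg Subtype.val h)), ?_⟩
    rintro ⟨e, he⟩
    obtain ⟨τ, k, hτa, hform⟩ := exists_of_mem_ntAut hσ hord hr.two_le hσa e he
    have hτ : τ = 1 := eq_one_of_apply_eq_algebraMap_mul hr hcard hnd ha τ _ (hnorm k ▸ hτa)
    subst hτ
    have ha0 : a ≠ 0 := by
      rintro rfl
      exact ha ⟨0, map_zero _⟩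
    have hk : partialNorm σ r k = 1 := (mul_eq_right₀ ha0).1 hτa.symm
    have hk0 : k ≠ 0 := by
      rintro rfl
      simp [hnorm] at hk
    refine ⟨⟨Units.mk0 k hk0, (hG _).2 hk⟩, Subtype.ext (LinearEquiv.ext fun x => ?_)⟩
    funext i
    exact (hform x i).symm
  refine ⟨(MulEquiv.ofBijective Φ hΦ).symm.trans (mulEquivOfCyclicCardEq ?_)⟩
  rw [card_ker_unitsMap_norm, hrank, Nat.card_eq_fintype_card (α := F)]
  exact (Nat.card_zmod _).symm
end
end
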